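/- arXiv:math/9802051 — 8 statements merged into one kernel-verified Lean document; each statement's English description precedes it below -/
import Mathlib

section
/- Let K be a field, V a finite-dimensional K-vector space, and N : V → V a nilpotent K-linear endomorphism. Then there exists an increasing filtration W : ℤ → Submodule K V (monotone in k) such that: (i) W k = ⊥ for all sufficiently small k and W k = ⊤ for all sufficiently large k; (ii) N maps W k into W (k−2) for every k ∈ ℤ; and (iii) for every k ≥ 0, N^k maps W k into W (−k) and the induced linear map on graded pieces Gr_k = (W k)/(W (k−1)) → Gr_{−k} = (W (−k))/(W (−k−1)) is an isomorphism. -/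
variable {K V : Type*} [Field K] [AddCommGroup V] [Module K V]

/-- The `k`-th graded piece `Gr_k = (W k)/(W (k-1))` of a `ℤ`-indexed filtration `W`. -/
abbrev gradedPiece (W : ℤ → Submodule K V) (k : ℤ) :=
  W k ⧸ (Submodule.comap (W k).subtype (W (k - 1)))

/-- The map `Gr_k → Gr_m` induced by a linear map `f` with `f (W k) ⊆ W m` and
`f (W (k-1)) ⊆ W (m-1)`. -/
def inducedMap (W : ℤ → Submodule K V) (f : V →ₗ[K] V) (k m : ℤ)
    (h1 : ∀ x ∈ W k, f x ∈ W m)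
    (h2 : ∀ x ∈ W (k - 1), f x ∈ W (m - 1)) :
    gradedPiece W k →ₗ[K] gradedPiece W m :=
  Submodule.mapQ _ _ (f.restrict h1) (fun x hx => h2 x.1 hx)

/-- `W` is a monodromy weight filtration for the nilpotent endomorphism `N`. -/
structure IsMonodromyWeightFiltration (W : ℤ → Submodule K V) (N : V →ₗ[K] V) : Prop where
  mono : Monotone W
  eventually_bot : ∃ a : ℤ, ∀ k : ℤ, k ≤ a → W k = ⊥
  eventually_top : ∃ b : ℤ, ∀ k : ℤ, b ≤ k → W k = ⊤
  map_le : ∀ k : ℤ, ∀ x ∈ W k, N x ∈ W (k - 2)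
  pow_maps : ∀ k : ℤ, 0 ≤ k → ∀ x ∈ W k, (N ^ k.toNat) x ∈ W (-k)
  pow_maps' : ∀ k : ℤ, 0 ≤ k → ∀ x ∈ W (k - 1), (N ^ k.toNat) x ∈ W (-k - 1)
  bijective : ∀ (k : ℤ) (hk : 0 ≤ k),
    Function.Bijective (inducedMap W (N ^ k.toNat) k (-k) (pow_maps k hk) (pow_maps' k hk))

theorem IsMonodromyWeightFiltration.pow_mem {W : ℤ → Submodule K V} {N : V →ₗ[K] V}
    (hW : IsMonodromyWeightFiltration W N) {j : ℕ} {k m : ℤ} (h : m = k - 2 * j) :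
    ∀ x ∈ W k, (N ^ j) x ∈ W m := by
  subst h
  induction j generalizing k with
  | zero => intro x hx; simpa using hx
  | succ n ih =>
      intro x hx
      have h2 := ih (k := k - 2) (N x) (hW.map_le k x hx)
      have he : (N ^ (n + 1)) x = (N ^ n) (N x) := by
        rw [pow_succ]; rfl
      rw [he]
      convert h2 using 2
      push_cast; ring

theorem IsMonodromyWeightFiltration.map_mem {W : ℤ → Submodule K V} {N : V →ₗ[K] V}
    (hW : IsMonodromyWeightFiltration W N) {k m : ℤ} (h : m = k - 2) :
    ∀ x ∈ W k, N x ∈ W m := h ▸ hW.map_le k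

/-- The explicit filtration `W_k = ∑_j N^j (ker N^(k+2j+1))`. -/
def mwf (N : V →ₗ[K] V) (k : ℤ) : Submodule K V :=
  ⨆ j : ℕ, (LinearMap.ker (N ^ (k + 2 * j + 1).toNat)).map (N ^ j)

theorem mwf_mem (N : V →ₗ[K] V) {k : ℤ} (j : ℕ) {x : V}
    (hx : (N ^ (k + 2 * j + 1).toNat) x = 0) : (N ^ j) x ∈ mwf N k :=
  Submodule.mem_iSup_of_mem j (Submodule.mem_map_of_mem (LinearMap.mem_ker.2 hx))

theorem mwf_le (N : V →ₗ[K] V) {k : ℤ} {P : Submodule K V}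
    (h : ∀ (j : ℕ) (x : V), (N ^ (k + 2 * j + 1).toNat) x = 0 → (N ^ j) x ∈ P) :
    mwf N k ≤ P := by
  refine iSup_le fun j => ?_
  rintro _ ⟨x, hx, rfl⟩
  exact h j x (LinearMap.mem_ker.1 hx)

theorem pow_zero_of_le (N : V →ₗ[K] V) {a b : ℕ} (h : a ≤ b) {x : V}
    (hx : (N ^ a) x = 0) : (N ^ b) x = 0 := by
  obtain ⟨c, rfl⟩ := Nat.exists_eq_add_of_le' h
  rw [pow_add, Module.End.mul_apply, hx, map_zero]

theorem mwf_mono (N : V →ₗ[K] V) : Monotone (mwf N) := by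
  intro k m h
  exact mwf_le N fun j x hx => mwf_mem N j (pow_zero_of_le N (by omega) hx)

theorem mwf_pow (N : V →ₗ[K] V) (i : ℕ) {k m : ℤ} (h : m = k - 2 * i) :
    ∀ x ∈ mwf N k, (N ^ i) x ∈ mwf N m := by
  have : mwf N k ≤ (mwf N m).comap (N ^ i) := by
    refine mwf_le N fun j x hx => ?_
    rw [Submodule.mem_comap, ← Module.End.mul_apply, ← pow_add]
    exact mwf_mem N (i + j) (pow_zero_of_le N (by push_cast; omega) hx)
  exact this

theorem mwf_surj (N : V →ₗ[K] V) (i : ℕ) :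
    mwf N (-i) ≤ (mwf N i).map (N ^ i) := by
  refine mwf_le N fun j x hx => ?_
  by_cases hj : i ≤ j
  · obtain ⟨c, rfl⟩ := Nat.exists_eq_add_of_le hj
    rw [pow_add, Module.End.mul_apply]
    exact Submodule.mem_map_of_mem
      (mwf_mem N c (pow_zero_of_le N (by push_cast; omega) hx))
  · rw [pow_zero_of_le N (by omega) hx]
    exact zero_mem _

/-- Every nilpotent endomorphism of a finite-dimensional vector space
admits a monodromy weight filtration. -/
theorem exists_monodromyWeightFiltration [FiniteDimensional K V]
    (N : V →ₗ[K] V) (hN : IsNilpotent N) :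
    ∃ W : ℤ → Submodule K V, IsMonodromyWeightFiltration W N := by
  obtain ⟨d, hd⟩ := hN
  have hd' : ∀ x, (N ^ d) x = 0 := fun x => by rw [hd]; rfl
  refine ⟨mwf N, mwf_mono N, ⟨-2 * d - 1, fun k hk => ?_⟩, ⟨d, fun k hk => ?_⟩,
    fun k x hx => ?_, fun k hk => mwf_pow N _ (by omega),
    fun k hk => mwf_pow N _ (by omega), fun k hk => ⟨?_, ?_⟩⟩
  · refine le_bot_iff.1 (mwf_le N fun j x hx => ?_)
    rw [Submodule.mem_bot]
    by_cases hj : d ≤ j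
    · exact pow_zero_of_le N hj (hd' x)
    · exact pow_zero_of_le N (by omega) hx
  · refine eq_top_iff.2 fun x _ => ?_
    simpa using mwf_mem N (k := k) 0 (pow_zero_of_le N (by push_cast; omega) (hd' x))
  · simpa using mwf_pow N 1 (m := k - 2) (by norm_num) x hx
  · lift k to ℕ using hk
    rw [injective_iff_map_eq_zero]
    intro q hq
    obtain ⟨⟨x, hx⟩, rfl⟩ := Submodule.Quotient.mk_surjective _ q
    have hq' : (N ^ k) x ∈ mwf N (-(k : ℤ) - 1) := by
      have h0 := (Submodule.Quotient.mk_eq_zero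
        (Submodule.comap (mwf N (-(k : ℤ))).subtype (mwf N (-(k : ℤ) - 1)))
        (x := ⟨(N ^ k) x, mwf_pow N k (by ring) x hx⟩)).1 hq
      exact h0
    refine (Submodule.Quotient.mk_eq_zero _).2 ?_
    change x ∈ mwf N ((k : ℤ) - 1)
    have e : -(k : ℤ) - 1 = -((k + 1 : ℕ) : ℤ) := by push_cast; ring
    rw [e] at hq'
    obtain ⟨y, hy, hxy⟩ := mwf_surj N (k + 1) hq'
    have h1 : N y ∈ mwf N ((k : ℤ) - 1) := by
      simpa using mwf_pow N 1 (m := (k : ℤ) - 1) (by push_cast; ring) y hy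
    have h2 : x - N y ∈ mwf N ((k : ℤ) - 1) := by
      have h3 : (N ^ k) (x - N y) = 0 := by
        rw [map_sub, ← hxy, pow_succ, Module.End.mul_apply, sub_self]
      simpa using mwf_mem N (k := (k : ℤ) - 1) 0 (pow_zero_of_le N (by push_cast; omega) h3)
    simpa using add_mem h2 h1
  · lift k to ℕ using hk
    intro q
    obtain ⟨⟨x, hx⟩, rfl⟩ := Submodule.Quotient.mk_surjective _ q
    obtain ⟨y, hy, rfl⟩ := mwf_surj N k hx
    exact ⟨Submodule.Quotient.mk ⟨y, hy⟩, rfl⟩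
end

section
/- Let K be a field, V a finite-dimensional K-vector space, and N : V → V a nilpotent K-linear endomorphism. If W and W' are two monodromy weight filtrations for N, then W k = W' k for every k ∈ ℤ. -/
variable {K V : Type*} [Field K] [AddCommGroup V] [Module K V]

theorem IsMonodromyWeightFiltration.lower_iff {W : ℤ → Submodule K V} {N : V →ₗ[K] V}
    (hW : IsMonodromyWeightFiltration W N) {k : ℤ} (hk : 0 ≤ k) (x : V) :
    x ∈ W (k - 1) ↔ x ∈ W k ∧ (N ^ k.toNat) x ∈ W (-k - 1) := by
  constructor
  · intro hx
    exact ⟨hW.mono (by omega) hx, hW.pow_maps' k hk x hx⟩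
  · rintro ⟨hx, hNx⟩
    have hinj := (hW.bijective k hk).1
    have h0 : (Submodule.Quotient.mk ⟨x, hx⟩ : gradedPiece W k) = 0 := by
      apply hinj
      rw [map_zero]
      exact (Submodule.Quotient.mk_eq_zero _).2 hNx
    have h3 := (Submodule.Quotient.mk_eq_zero _).1 h0
    exact h3

theorem IsMonodromyWeightFiltration.neg_iff {W : ℤ → Submodule K V} {N : V →ₗ[K] V}
    (hW : IsMonodromyWeightFiltration W N) {k : ℤ} (hk : 0 ≤ k) (y : V) :
    y ∈ W (-k) ↔ ∃ x ∈ W k, (N ^ k.toNat) x - y ∈ W (-k - 1) := by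
  constructor
  · intro hy
    obtain ⟨q, hq⟩ := (hW.bijective k hk).2 (Submodule.Quotient.mk ⟨y, hy⟩)
    obtain ⟨x, rfl⟩ := Submodule.Quotient.mk_surjective _ q
    have h3 := (Submodule.Quotient.eq (Submodule.comap (W (-k)).subtype (W (-k - 1)))
      (x := (N ^ k.toNat).restrict (hW.pow_maps k hk) x) (y := ⟨y, hy⟩)).1 hq
    exact ⟨x.1, x.2, h3⟩
  · rintro ⟨x, hx, hxy⟩
    have h1 := hW.pow_maps k hk x hx
    have h2 : (N ^ k.toNat) x - y ∈ W (-k) := hW.mono (by omega) hxy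
    simpa using (W (-k)).sub_mem h1 h2

/-- The monodromy weight filtration of a nilpotent endomorphism is unique. -/
theorem monodromyWeightFiltration_unique [FiniteDimensional K V]
    {N : V →ₗ[K] V} (hN : IsNilpotent N) {W W' : ℤ → Submodule K V}
    (hW : IsMonodromyWeightFiltration W N) (hW' : IsMonodromyWeightFiltration W' N) :
    ∀ k : ℤ, W k = W' k := by
  obtain ⟨a, ha⟩ := hW.eventually_bot
  obtain ⟨a', ha'⟩ := hW'.eventually_bot
  obtain ⟨b, hb⟩ := hW.eventually_top
  obtain ⟨b', hb'⟩ := hW'.eventually_top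
  obtain ⟨M, hM⟩ : ∃ M : ℤ, b ≤ M ∧ b' ≤ M ∧ -M - 1 ≤ a ∧ -M - 1 ≤ a' :=
    ⟨|a| + |a'| + |b| + |b'|, by
      have := neg_abs_le a
      have := neg_abs_le a'
      have := le_abs_self b
      have := le_abs_self b'
      have := abs_nonneg a
      have := abs_nonneg a'
      have := abs_nonneg b
      have := abs_nonneg b'
      omega⟩
  have key : ∀ j : ℕ, ∀ n : ℤ, -1 ≤ n → M ≤ n + j →
      W n = W' n ∧ W (-n - 1) = W' (-n - 1) := by
    intro j
    induction j with
    | zero =>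
      intro n _ hn
      rw [hb n (by omega), hb' n (by omega), ha _ (by omega), ha' _ (by omega)]
      exact ⟨rfl, rfl⟩
    | succ j ih =>
      intro n hn hMn
      obtain ⟨m, rfl⟩ : ∃ m, n = m - 1 := ⟨n + 1, by omega⟩
      have hm : 0 ≤ m := by omega
      obtain ⟨h1, h2⟩ := ih m (by omega) (by push_cast at hMn; omega)
      refine ⟨?_, ?_⟩
      · ext x
        rw [hW.lower_iff hm, hW'.lower_iff hm, h1, h2]
      · rw [show -(m - 1) - 1 = -m by ring]
        ext x
        rw [hW.neg_iff hm, hW'.neg_iff hm, h1, h2]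
  intro k
  by_cases hk : 0 ≤ k
  · exact (key (M - k).toNat k (by omega) (by omega)).1
  · have := (key (M - (-k - 1)).toNat (-k - 1) (by omega) (by omega)).2
    rwa [show -(-k - 1) - 1 = k by ring] at this
end

section
/- Let K be a field, V a finite-dimensional K-vector space, and N : V → V a nilpotent K-linear endomorphism. Define, for each k ∈ ℤ, W k = ⨆_{j ≥ max(0, −k)} (ker(N^{j+k+1}) ⊓ range(N^j)) (a supremum of submodules of V, where N^i denotes the i-th iterate of N). Then this W is a monodromy weight filtration for N. -/
variable {K V : Type*} [Field K] [AddCommGroup V] [Module K V]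

/-- The explicit filtration. -/
def kerRangeFil (N : V →ₗ[K] V) (k : ℤ) : Submodule K V :=
  ⨆ (j : ℤ) (_ : max 0 (-k) ≤ j),
    LinearMap.ker (N ^ (j + k + 1).toNat) ⊓ LinearMap.range (N ^ j.toNat)

/-- Generators, with natural number exponents. -/
theorem kerRangeFil_gen (N : V →ₗ[K] V) {k : ℤ} {j l : ℕ} (h : (l : ℤ) = j + k + 1)
    {y : V} (hy : (N ^ (l + j)) y = 0) : (N ^ j) y ∈ kerRangeFil N k := by
  rcases Nat.eq_zero_or_pos l with h0 | h0
  · subst h0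
    rw [zero_add] at hy
    rw [hy]
    exact zero_mem _
  · have hj : max 0 (-k) ≤ (j : ℤ) := by
      apply max_le <;> omega
    refine Submodule.mem_iSup_of_mem (j : ℤ) (Submodule.mem_iSup_of_mem hj ?_)
    have e : ((j : ℤ) + k + 1).toNat = l := by omega
    rw [e, Int.toNat_natCast]
    refine ⟨?_, y, rfl⟩
    rw [SetLike.mem_coe, LinearMap.mem_ker, ← Module.End.mul_apply, ← pow_add]
    exact hy

theorem kerRangeFil_le (N : V →ₗ[K] V) {k : ℤ} {S : Submodule K V}
    (h : ∀ (j l : ℕ), 1 ≤ l → (l : ℤ) = j + k + 1 → ∀ y, (N ^ (l + j)) y = 0 → (N ^ j) y ∈ S) :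
    kerRangeFil N k ≤ S := by
  refine iSup_le fun j => iSup_le fun hj => ?_
  rintro x ⟨hx, y, rfl⟩
  have h1 := le_trans (le_max_left _ _) hj
  have h2 := le_trans (le_max_right _ _) hj
  refine h j.toNat (j + k + 1).toNat (by omega) (by omega) y ?_
  rw [pow_add, Module.End.mul_apply]
  exact hx

theorem kerRangeFil_map (N : V →ₗ[K] V) (k m : ℤ) (hm : m = k - 2) :
    ∀ x ∈ kerRangeFil N k, N x ∈ kerRangeFil N m := by
  suffices kerRangeFil N k ≤ (kerRangeFil N m).comap N from this
  refine kerRangeFil_le N fun j l hl h y hy => ?_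
  rw [Submodule.mem_comap, ← Module.End.mul_apply, ← pow_succ']
  refine kerRangeFil_gen N (l := l - 1) (by push_cast [hl]; omega) ?_
  rwa [show l - 1 + (j + 1) = l + j by omega]

theorem kerRangeFil_pow (N : V →ₗ[K] V) (n : ℕ) : ∀ (k m : ℤ), m = k - 2 * n →
    ∀ x ∈ kerRangeFil N k, (N ^ n) x ∈ kerRangeFil N m := by
  induction n with
  | zero => intro k m hm x hx; obtain rfl : m = k := by simpa using hm
            simpa using hx
  | succ n ih =>
    intro k m hm x hx
    rw [pow_succ, Module.End.mul_apply]
    exact ih (k - 2) m (by push_cast at hm; omega) _ (kerRangeFil_map N k _ rfl x hx)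

theorem kerRangeFil_surj (N : V →ₗ[K] V) (n : ℕ) (k m : ℤ) (hk : k = n) (hm : m = -n) :
    ∀ x ∈ kerRangeFil N m, ∃ z ∈ kerRangeFil N k, (N ^ n) z = x := by
  suffices kerRangeFil N m ≤ (kerRangeFil N k).map (N ^ n) from this
  refine kerRangeFil_le N fun j l hl h y hy => ?_
  refine ⟨(N ^ (j - n)) y, ?_, ?_⟩
  · refine kerRangeFil_gen N (l := j + 1) (by omega) ?_
    rwa [show j + 1 + (j - n) = l + j by omega]
  · rw [← Module.End.mul_apply, ← pow_add, show n + (j - n) = j by omega]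

theorem kerRangeFil_inj (N : V →ₗ[K] V) (n : ℕ) (k m : ℤ) (hk : k = n - 1) (hm : m = -n - 1)
    (x : V) (hx : (N ^ n) x ∈ kerRangeFil N m) : x ∈ kerRangeFil N k := by
  obtain ⟨w, hw, hwx⟩ := kerRangeFil_surj N (n + 1) (n + 1) m (by simp) (by push_cast; omega) _ hx
  have h1 := kerRangeFil_map N (n + 1) k (by omega) w hw
  have h2 : x - N w ∈ kerRangeFil N k := by
    have := kerRangeFil_gen N (k := k) (j := 0) (l := n) (y := x - N w) (by simp; omega) (by
      rw [add_zero, map_sub, ← hwx, pow_succ, Module.End.mul_apply, sub_self])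
    simpa using this
  simpa using add_mem h2 h1

theorem kerRangeFil_isMonodromy {N : V →ₗ[K] V} (hN : IsNilpotent N) :
    IsMonodromyWeightFiltration (kerRangeFil N) N := by
  obtain ⟨n, hn⟩ := hN
  have hz : ∀ i, n ≤ i → N ^ i = 0 := fun i hi => pow_eq_zero_of_le hi hn
  refine ⟨?_, ⟨-n, ?_⟩, ⟨n, ?_⟩, fun k => kerRangeFil_map N k _ rfl, ?_, ?_, ?_⟩
  · intro a b hab
    refine kerRangeFil_le N fun j l hl h y hy => ?_
    refine kerRangeFil_gen N (l := l + (b - a).toNat) (by push_cast; omega) ?_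
    rw [show l + (b - a).toNat + j = (b - a).toNat + (l + j) by omega, pow_add,
      Module.End.mul_apply, hy, map_zero]
  · intro k hk
    refine le_bot_iff.1 (kerRangeFil_le N fun j l hl h y hy => ?_)
    rw [hz j (by omega)]
    simp
  · intro k hk
    refine top_le_iff.1 fun x _ => ?_
    have := kerRangeFil_gen N (k := k) (j := 0) (l := (k + 1).toNat) (y := x)
      (by push_cast; omega) (by rw [hz _ (by omega)]; simp)
    simpa using this
  · intro k hk
    exact kerRangeFil_pow N _ _ _ (by omega)
  · intro k hk
    exact kerRangeFil_pow N _ _ _ (by omega)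
  · intro k hk
    constructor
    · rw [← LinearMap.ker_eq_bot, LinearMap.ker_eq_bot']
      intro q
      obtain ⟨x, rfl⟩ := Submodule.Quotient.mk_surjective _ q
      intro hx
      have hx' := (Submodule.Quotient.mk_eq_zero _).1 hx
      exact (Submodule.Quotient.mk_eq_zero _).2
        (kerRangeFil_inj N k.toNat (k - 1) (-k - 1) (by omega) (by omega) x.1 hx')
    · intro q
      obtain ⟨x, rfl⟩ := Submodule.Quotient.mk_surjective _ q
      obtain ⟨z, hz, hzx⟩ := kerRangeFil_surj N k.toNat k (-k) (by omega) (by omega) x.1 x.2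
      refine ⟨Submodule.Quotient.mk ⟨z, hz⟩, ?_⟩
      exact congrArg Submodule.Quotient.mk (Subtype.ext hzx)

/-- The explicit kernel-image formula
`W k = ⨆_{j ≥ max(0,−k)} (ker N^{j+k+1} ⊓ range N^j)` yields a monodromy weight
filtration for `N`. -/
theorem isMonodromyWeightFiltration_iSup_ker_inf_range [FiniteDimensional K V]
    {N : V →ₗ[K] V} (hN : IsNilpotent N) :
    IsMonodromyWeightFiltration
      (fun k : ℤ => ⨆ (j : ℤ) (_ : max 0 (-k) ≤ j),
        LinearMap.ker (N ^ (j + k + 1).toNat) ⊓ LinearMap.range (N ^ j.toNat)) N := by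
  exact kerRangeFil_isMonodromy hN
end

section
/- Let K be a field, V a finite-dimensional K-vector space, N : V → V a nilpotent K-linear endomorphism with monodromy weight filtration W, and g : V ≃ V a K-linear automorphism such that N ∘ g = c • (g ∘ N) for some nonzero scalar c ∈ K. Then g preserves the filtration: g(W k) = W k for every k ∈ ℤ. -/
variable {K V : Type*} [Field K] [AddCommGroup V] [Module K V]

theorem IsMonodromyWeightFiltration.inj_step {W : ℤ → Submodule K V} {N : V →ₗ[K] V}
    (hW : IsMonodromyWeightFiltration W N) (l : ℕ) (x : V) (hx : x ∈ W l)
    (h : (N ^ l) x = 0) : x ∈ W (l - 1) := by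
  have hi := (hW.bijective l (by positivity)).1
  have h0 : (Submodule.Quotient.mk ⟨x, hx⟩ : gradedPiece W l) = 0 := by
    apply hi
    rw [map_zero]
    refine (Submodule.Quotient.mk_eq_zero _).2 ?_
    change (N ^ l) x ∈ W (-l - 1)
    rw [h]
    exact zero_mem _
  rw [Submodule.Quotient.mk_eq_zero] at h0
  exact h0

theorem IsMonodromyWeightFiltration.surj_step {W : ℤ → Submodule K V} {N : V →ₗ[K] V}
    (hW : IsMonodromyWeightFiltration W N) (l : ℕ) (y : V) (hy : y ∈ W (-l)) :
    ∃ x ∈ W l, y - (N ^ l) x ∈ W (-l - 1) := by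
  obtain ⟨q, hq⟩ := (hW.bijective l (by positivity)).2 (Submodule.Quotient.mk ⟨y, hy⟩)
  obtain ⟨⟨x, hx⟩, rfl⟩ := Submodule.Quotient.mk_surjective _ q
  refine ⟨x, hx, ?_⟩
  have h2 := (Submodule.Quotient.eq (Submodule.comap (W (-l)).subtype (W (-l - 1)))
    (x := ⟨y, hy⟩) (y := ⟨(N ^ l) x, hW.pow_maps l (by positivity) x hx⟩)).1 hq.symm
  exact h2

theorem IsMonodromyWeightFiltration.surj {W : ℤ → Submodule K V} {N : V →ₗ[K] V}
    (hW : IsMonodromyWeightFiltration W N) (l : ℕ) (y : V) (hy : y ∈ W (-l)) :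
    ∃ x ∈ W l, y = (N ^ l) x := by
  obtain ⟨a, ha⟩ := hW.eventually_bot
  have key : ∀ n : ℕ, ∀ l : ℕ, -(l : ℤ) - n ≤ a → ∀ y ∈ W (-l), ∃ x ∈ W l, y = (N ^ l) x := by
    intro n
    induction n with
    | zero =>
      intro l hl y hy
      rw [ha _ (by simpa using hl)] at hy
      exact ⟨0, zero_mem _, by simpa using hy⟩
    | succ n ih =>
      intro l hl y hy
      obtain ⟨x, hx, hxy⟩ := hW.surj_step l y hy
      obtain ⟨z, hz, hzy⟩ := ih (l + 1) (by push_cast at hl ⊢; linarith) _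
        (by convert hxy using 2; push_cast; ring)
      refine ⟨x + N z, add_mem hx (hW.mono (by push_cast; linarith) (hW.map_le _ z hz)), ?_⟩
      rw [map_add, ← sub_eq_iff_eq_add', hzy, pow_succ]
      rfl
  exact key (-(l : ℤ) - a).toNat l (by have := Int.self_le_toNat (-(l : ℤ) - a); linarith) y hy

theorem IsMonodromyWeightFiltration.ker_le {W : ℤ → Submodule K V} {N : V →ₗ[K] V}
    (hW : IsMonodromyWeightFiltration W N) (m : ℕ) (x : V) (hx : (N ^ (m + 1)) x = 0) :
    x ∈ W m := by
  obtain ⟨b, hb⟩ := hW.eventually_top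
  have key : ∀ n : ℕ, x ∈ W ((m + n : ℕ) : ℤ) → x ∈ W m := by
    intro n
    induction n with
    | zero => exact id
    | succ n ih =>
      intro h
      apply ih
      have h1 := hW.inj_step _ x h (by
        rw [show m + (n + 1) = n + (m + 1) by ring, pow_add, Module.End.mul_apply, hx, map_zero])
      convert h1 using 2
      push_cast; ring
  apply key (b - m).toNat
  rw [hb _ (by have := Int.self_le_toNat (b - m); push_cast at this ⊢; linarith)]
  trivial

theorem IsMonodromyWeightFiltration.map_mem_self {W : ℤ → Submodule K V} {N : V →ₗ[K] V}
    (hW : IsMonodromyWeightFiltration W N) (g : V →ₗ[K] V) {c : K} (hc : c ≠ 0)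
    (hcomm : N ∘ₗ g = c • (g ∘ₗ N)) (k : ℤ) (x : V) (hx : x ∈ W k) : g x ∈ W k := by
  have h1 : ∀ v, N (g v) = c • g (N v) := fun v => by
    simpa using LinearMap.congr_fun hcomm v
  have hp : ∀ (n : ℕ) (v : V), (N ^ n) (g v) = c ^ n • g ((N ^ n) v) := by
    intro n
    induction n with
    | zero => intro v; simp
    | succ n ih =>
      intro v
      rw [pow_succ, Module.End.mul_apply, h1, map_smul, ih, smul_smul, Module.End.mul_apply,
        pow_succ' c]
  obtain ⟨b, hb⟩ := hW.eventually_top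
  have key : ∀ n k : ℕ, b ≤ (k : ℤ) + n → ∀ x ∈ W k, g x ∈ W k := by
    intro n
    induction n with
    | zero =>
      intro k hk x _
      rw [hb _ (by simpa using hk)]
      trivial
    | succ n ih =>
      intro k hk x hx
      obtain ⟨y, hy, hxy⟩ := hW.surj (k + 2) ((N ^ (k + 1)) x)
        (hW.pow_mem (by push_cast; ring) x hx)
      have hg := ih (k + 2) (by push_cast at hk ⊢; linarith) y hy
      have hker : g (x - N y) ∈ W k := by
        apply hW.ker_le
        rw [hp, map_sub, hxy, ← Module.End.mul_apply, ← pow_succ, sub_self, map_zero, smul_zero]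
      have hNy : g (N y) ∈ W k := by
        have h3 : N (g y) ∈ W k := hW.map_mem (by push_cast; ring) _ hg
        rw [h1] at h3
        exact (Submodule.smul_mem_iff _ hc).1 h3
      have := add_mem hker hNy
      rwa [← map_add, sub_add_cancel] at this
  have pos : ∀ k : ℕ, ∀ x ∈ W k, g x ∈ W k := fun k =>
    key (b - k).toNat k (by have := Int.self_le_toNat (b - k); linarith)
  obtain ⟨l, rfl | rfl⟩ := k.eq_nat_or_neg
  · exact pos l x hx
  · obtain ⟨y, hy, rfl⟩ := hW.surj l x hx
    have h3 : (N ^ l) (g y) ∈ W (-l) := hW.pow_mem (by ring) _ (pos l y hy)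
    rw [hp] at h3
    exact (Submodule.smul_mem_iff _ (pow_ne_zero l hc)).1 h3

/-- If `N ∘ g = c • (g ∘ N)` for a nonzero scalar `c`, then the
automorphism `g` preserves the monodromy weight filtration of `N`. -/
theorem monodromyWeightFiltration_map_eq_self [FiniteDimensional K V]
    {N : V →ₗ[K] V} (hN : IsNilpotent N)
    {W : ℤ → Submodule K V} (hW : IsMonodromyWeightFiltration W N)
    (g : V ≃ₗ[K] V) {c : K} (hc : c ≠ 0)
    (hcomm : N ∘ₗ g.toLinearMap = c • (g.toLinearMap ∘ₗ N)) :
    ∀ k : ℤ, Submodule.map g.toLinearMap (W k) = W k := by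
  intro k
  apply Submodule.eq_of_le_of_finrank_eq
  · rintro _ ⟨x, hx, rfl⟩
    exact hW.map_mem_self g.toLinearMap hc hcomm k x hx
  · exact LinearEquiv.finrank_map_eq g (W k)
end

section
/- Let K be a field, V a finite-dimensional K-vector space, and N : V → V a nilpotent K-linear endomorphism with monodromy weight filtration W. For every k ≥ 0, the graded piece Gr_k = (W k)/(W (k−1)) is the internal direct sum of the primitive part P_k = ker(N̄^{k+1} : Gr_k → Gr_{−k−2}) and the image of the map N̄ : Gr_{k+2} → Gr_k induced by N; that is, Gr_k = P_k ⊕ N̄(Gr_{k+2}). -/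
variable {K V : Type*} [Field K] [AddCommGroup V] [Module K V]

theorem IsMonodromyWeightFiltration.bijective_of_eq {W : ℤ → Submodule K V} {N : V →ₗ[K] V}
    (hW : IsMonodromyWeightFiltration W N) {m n : ℤ} {j : ℕ} (hm : 0 ≤ m) (hn : n = -m)
    (hj : j = m.toNat) (h1 : ∀ x ∈ W m, (N ^ j) x ∈ W n)
    (h2 : ∀ x ∈ W (m - 1), (N ^ j) x ∈ W (n - 1)) :
    Function.Bijective (inducedMap W (N ^ j) m n h1 h2) := by
  subst hn hj
  exact hW.bijective m hm

theorem ker_range_of_comp_bijective {A B C : Type*} [AddCommGroup A] [AddCommGroup B]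
    [AddCommGroup C] [Module K A] [Module K B] [Module K C] (f : A →ₗ[K] B) (g : B →ₗ[K] C)
    (h : Function.Bijective (fun x => g (f x))) :
    LinearMap.ker g ⊓ LinearMap.range f = ⊥ ∧ LinearMap.ker g ⊔ LinearMap.range f = ⊤ := by
  constructor
  · rw [eq_bot_iff]
    rintro _ ⟨hb, a, rfl⟩
    have hb' : g (f a) = 0 := hb
    have : a = 0 := h.1 (by simp [hb'])
    simp [this]
  · rw [eq_top_iff]
    intro b _
    obtain ⟨a, ha⟩ := h.2 (g b)
    have ha' : g (f a) = g b := ha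
    rw [Submodule.mem_sup]
    exact ⟨b - f a, by simp [ha'], f a, ⟨a, rfl⟩, by simp⟩

/-- For `k ≥ 0`, the graded piece `Gr_k` is the internal direct sum of
the primitive part `P_k = ker (N̄^{k+1} : Gr_k → Gr_{-k-2})` and the image of
`N̄ : Gr_{k+2} → Gr_k`. -/
theorem gradedPiece_eq_primitive_sup_image [FiniteDimensional K V]
    {N : V →ₗ[K] V} (hN : IsNilpotent N)
    {W : ℤ → Submodule K V} (hW : IsMonodromyWeightFiltration W N)
    (k : ℤ) (hk : 0 ≤ k) :
    LinearMap.ker (inducedMap W (N ^ (k.toNat + 1)) k (-k - 2)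
        (hW.pow_mem (by omega)) (hW.pow_mem (by omega))) ⊓
      LinearMap.range (inducedMap W N (k + 2) k
        (hW.map_mem (by omega)) (hW.map_mem (by omega))) = ⊥ ∧
    LinearMap.ker (inducedMap W (N ^ (k.toNat + 1)) k (-k - 2)
        (hW.pow_mem (by omega)) (hW.pow_mem (by omega))) ⊔
      LinearMap.range (inducedMap W N (k + 2) k
        (hW.map_mem (by omega)) (hW.map_mem (by omega))) = ⊤ := by
  apply ker_range_of_comp_bijective
  have hb := hW.bijective_of_eq (m := k + 2) (n := -k - 2) (j := k.toNat + 1 + 1)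
    (by omega) (by omega) (by omega) (hW.pow_mem (by omega)) (hW.pow_mem (by omega))
  convert hb using 1
  funext x
  obtain ⟨x, rfl⟩ := Submodule.Quotient.mk_surjective _ x
  refine congrArg (Submodule.Quotient.mk (p := Submodule.comap (W (-k - 2)).subtype
    (W (-k - 2 - 1)))) (Subtype.ext ?_)
  change (N ^ (k.toNat + 1)) (N x) = (N ^ (k.toNat + 1 + 1)) x
  rw [pow_succ N (k.toNat + 1)]
  rfl
end

section
/- Let K be a field, V a finite-dimensional K-vector space, and N : V → V a nilpotent K-linear endomorphism with monodromy weight filtration W. Then for every k ∈ ℤ, the dimension of the graded piece Gr_k = (W k)/(W (k−1)) equals the (finite) sum over m ≥ 0 of the dimensions of the primitive parts P_{|k|+2m}: dim Gr_k = Σ_{m ≥ 0} dim P_{|k|+2m}. -/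
variable {K V : Type*} [Field K] [AddCommGroup V] [Module K V]

theorem inducedMap_surj_iff (W : ℤ → Submodule K V) (f : V →ₗ[K] V) (k m : ℤ)
    (h1 : ∀ x ∈ W k, f x ∈ W m) (h2 : ∀ x ∈ W (k - 1), f x ∈ W (m - 1)) :
    Function.Surjective (inducedMap W f k m h1 h2) ↔
      ∀ y ∈ W m, ∃ x ∈ W k, f x - y ∈ W (m - 1) := by
  constructor
  · intro h y hy
    obtain ⟨q, hq⟩ := h (Submodule.Quotient.mk ⟨y, hy⟩)
    obtain ⟨x, rfl⟩ := Submodule.Quotient.mk_surjective _ q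
    refine ⟨x.1, x.2, ?_⟩
    have := (Submodule.Quotient.eq _).1 hq
    exact this
  · intro h q
    obtain ⟨y, rfl⟩ := Submodule.Quotient.mk_surjective _ q
    obtain ⟨x, hx, hxy⟩ := h y.1 y.2
    refine ⟨Submodule.Quotient.mk ⟨x, hx⟩, ?_⟩
    exact (Submodule.Quotient.eq _).2 hxy

theorem finrank_gradedPiece_neg [FiniteDimensional K V] {N : V →ₗ[K] V}
    {W : ℤ → Submodule K V} (hW : IsMonodromyWeightFiltration W N) (k : ℤ) (hk : 0 ≤ k) :
    Module.finrank K (gradedPiece W k) = Module.finrank K (gradedPiece W (-k)) :=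
  (LinearEquiv.ofBijective _ (hW.bijective k hk)).finrank_eq

theorem finrank_gradedPiece_step [FiniteDimensional K V] {N : V →ₗ[K] V}
    {W : ℤ → Submodule K V} (hW : IsMonodromyWeightFiltration W N) (j : ℕ) (z w : ℤ)
    (hz : (j : ℤ) = z + 1) (hz0 : 0 ≤ z) (hw : w = -z - 2)
    (h1 : ∀ x ∈ W z, (N ^ j) x ∈ W w) (h2 : ∀ x ∈ W (z - 1), (N ^ j) x ∈ W (w - 1)) :
    Module.finrank K (gradedPiece W z) =
      Module.finrank K (LinearMap.ker (inducedMap W (N ^ j) z w h1 h2)) +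
        Module.finrank K (gradedPiece W (z + 2)) := by
  have hs : Function.Surjective (inducedMap W (N ^ j) z w h1 h2) := by
    rw [inducedMap_surj_iff]
    have h := (inducedMap_surj_iff _ _ _ _ _ _).1 (hW.bijective (z + 2) (by omega)).surjective
    have e : -(z + 2) = w := by omega
    have e2 : (z + 2).toNat = j + 1 := by omega
    rw [e, e2] at h
    intro y hy
    obtain ⟨x, hx, hxy⟩ := h y hy
    refine ⟨N x, hW.map_mem (by omega) x hx, ?_⟩
    rw [pow_succ] at hxy
    exact hxy
  have e : w = -(z + 2) := by omega
  have hr := LinearMap.finrank_range_add_finrank_ker (inducedMap W (N ^ j) z w h1 h2)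
  rw [LinearMap.range_eq_top.2 hs, finrank_top] at hr
  rw [finrank_gradedPiece_neg hW (z + 2) (by omega), ← e]
  omega

theorem finrank_gradedPiece_large {N : V →ₗ[K] V}
    {W : ℤ → Submodule K V} (hW : IsMonodromyWeightFiltration W N) :
    ∃ b : ℤ, ∀ z, b ≤ z → Module.finrank K (gradedPiece W z) = 0 := by
  obtain ⟨b, hb⟩ := hW.eventually_top
  refine ⟨b + 1, fun z hz => ?_⟩
  have : Subsingleton (gradedPiece W z) := by
    rw [Submodule.Quotient.subsingleton_iff, hb (z - 1) (by omega)]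
    rfl
  exact Module.finrank_zero_of_subsingleton

/-- For every `k ∈ ℤ`, `dim Gr_k = Σ_{m ≥ 0} dim P_{|k|+2m}`. -/
theorem finrank_gradedPiece_eq_finsum_primitive [FiniteDimensional K V]
    {N : V →ₗ[K] V} (hN : IsNilpotent N)
    {W : ℤ → Submodule K V} (hW : IsMonodromyWeightFiltration W N) (k : ℤ) :
    Module.finrank K (gradedPiece W k) =
      ∑ᶠ m : ℕ, Module.finrank K
        (LinearMap.ker (inducedMap W (N ^ (k.natAbs + 2 * m + 1))
          ((k.natAbs : ℤ) + 2 * m) (-((k.natAbs : ℤ) + 2 * m) - 2)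
          (hW.pow_mem (by omega)) (hW.pow_mem (by omega)))) := by
  have key : ∀ m : ℕ, _ := fun m : ℕ => finrank_gradedPiece_step hW (k.natAbs + 2 * m + 1)
    ((k.natAbs : ℤ) + 2 * m) (-((k.natAbs : ℤ) + 2 * m) - 2) (by push_cast; ring) (by positivity)
    rfl (hW.pow_mem (by omega)) (hW.pow_mem (by omega))
  have h0 : Module.finrank K (gradedPiece W k) =
      Module.finrank K (gradedPiece W (k.natAbs : ℤ)) := by
    rcases Int.natAbs_eq k with h | h
    · rw [← h]
    · rw [finrank_gradedPiece_neg hW (k.natAbs : ℤ) (by positivity), ← h]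
  rw [h0]
  generalize hp : (fun m : ℕ => Module.finrank K
        (LinearMap.ker (inducedMap W (N ^ (k.natAbs + 2 * m + 1))
          ((k.natAbs : ℤ) + 2 * m) (-((k.natAbs : ℤ) + 2 * m) - 2)
          (hW.pow_mem (by omega)) (hW.pow_mem (by omega))))) = p
  have key' : ∀ m : ℕ, Module.finrank K (gradedPiece W ((k.natAbs : ℤ) + 2 * m)) =
      p m + Module.finrank K (gradedPiece W ((k.natAbs : ℤ) + 2 * m + 2)) := by
    intro m; rw [← hp]; exact key m
  have hsum : ∀ M : ℕ, Module.finrank K (gradedPiece W (k.natAbs : ℤ)) =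
      ∑ m ∈ Finset.range M, p m +
        Module.finrank K (gradedPiece W ((k.natAbs : ℤ) + 2 * M)) := by
    intro M
    induction M with
    | zero =>
      have e : (k.natAbs : ℤ) + 2 * ((0 : ℕ) : ℤ) = k.natAbs := by simp
      rw [e]; simp
    | succ M ih =>
      have e : (k.natAbs : ℤ) + 2 * ((M + 1 : ℕ) : ℤ) = (k.natAbs : ℤ) + 2 * M + 2 := by
        push_cast; ring
      rw [ih, key' M, Finset.sum_range_succ, e]
      exact (add_assoc _ _ _).symm
  obtain ⟨b, hb⟩ := finrank_gradedPiece_large hW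
  have hbig : ∀ m : ℕ, b.toNat ≤ m →
      Module.finrank K (gradedPiece W ((k.natAbs : ℤ) + 2 * m)) = 0 :=
    fun m hm => hb _ (by omega)
  rw [hsum b.toNat, hbig _ le_rfl, add_zero]
  symm
  apply finsum_eq_sum_of_support_subset
  intro m hm
  by_contra hc
  have hc' : b.toNat ≤ m := by simpa using hc
  have h3 := key' m
  rw [hbig m hc'] at h3
  exact hm (by omega)
end

section
/- Let K be a field, V a finite-dimensional K-vector space, and N : V → V a nilpotent K-linear endomorphism with monodromy weight filtration W. Then N is strict with respect to the filtration shifted by −2: for every k ∈ ℤ, the image N(W k) equals range(N) ⊓ W (k−2) as submodules of V. -/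
variable {K V : Type*} [Field K] [AddCommGroup V] [Module K V]

theorem mwf_inj {W : ℤ → Submodule K V} {N : V →ₗ[K] V}
    (hW : IsMonodromyWeightFiltration W N) (k : ℤ) (hk : 0 ≤ k) (x : V) (hx : x ∈ W k)
    (h : (N ^ k.toNat) x ∈ W (-k - 1)) : x ∈ W (k - 1) := by
  have hi := (hW.bijective k hk).1
  have h0 : (Submodule.Quotient.mk ⟨x, hx⟩ : gradedPiece W k) = 0 := by
    apply hi
    rw [map_zero]
    exact (Submodule.Quotient.mk_eq_zero _).2 h
  have h1 := (Submodule.Quotient.mk_eq_zero _).1 h0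
  exact h1

theorem mwf_surj_s9 {W : ℤ → Submodule K V} {N : V →ₗ[K] V}
    (hW : IsMonodromyWeightFiltration W N) (k : ℤ) (hk : 0 ≤ k) (y : V) (hy : y ∈ W (-k)) :
    ∃ x ∈ W k, y - (N ^ k.toNat) x ∈ W (-k - 1) := by
  obtain ⟨q, hq⟩ := (hW.bijective k hk).2 (Submodule.Quotient.mk ⟨y, hy⟩)
  obtain ⟨⟨x, hx⟩, rfl⟩ := Submodule.Quotient.mk_surjective _ q
  have h1 := (Submodule.Quotient.eq _).1 hq.symm
  exact ⟨x, hx, h1⟩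

theorem mwf_lift {W : ℤ → Submodule K V} {N : V →ₗ[K] V}
    (hW : IsMonodromyWeightFiltration W N) (a : ℤ) (ha : ∀ k : ℤ, k ≤ a → W k = ⊥) (n : ℕ) :
    ∀ m : ℤ, m ≤ -1 → m ≤ a + n → ∀ y ∈ W m, ∃ x ∈ W (m + 2), N x = y := by
  induction n with
  | zero =>
    intro m _ hm y hy
    rw [ha m (by simpa using hm), Submodule.mem_bot] at hy
    exact ⟨0, zero_mem _, by simp [hy]⟩
  | succ n ih =>
    intro m hm1 hm y hy
    obtain ⟨x, hx, hxy⟩ := mwf_surj_s9 hW (-m) (by omega) y (by simpa using hy)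
    obtain ⟨z, hz, hzy⟩ := ih (m - 1) (by omega) (by push_cast at hm; omega) _
      (by simpa using hxy)
    obtain ⟨j, hj⟩ : ∃ j : ℕ, (-m).toNat = j + 1 := ⟨(-m).toNat - 1, by omega⟩
    refine ⟨(N ^ j) x + z, add_mem (hW.pow_mem (by omega) x hx)
      (hW.mono (by omega) hz), ?_⟩
    rw [map_add, hzy, hj, pow_succ', Module.End.mul_apply]
    abel

theorem mwf_descend {W : ℤ → Submodule K V} {N : V →ₗ[K] V}
    (hW : IsMonodromyWeightFiltration W N) (k : ℤ) (hk : 0 ≤ k) (n : ℕ) :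
    ∀ x ∈ W (k + n), N x ∈ W (k - 2) → x ∈ W k := by
  induction n with
  | zero => intro x hx _; simpa using hx
  | succ n ih =>
    intro x hx h
    refine ih x ?_ h
    have := mwf_inj hW (k + (n + 1 : ℕ)) (by omega) x hx ?_
    · convert this using 2
      push_cast; ring
    obtain ⟨j, hj⟩ : ∃ j : ℕ, (k + (n + 1 : ℕ)).toNat = j + 1 :=
      ⟨(k + (n + 1 : ℕ)).toNat - 1, by omega⟩
    rw [hj, pow_succ, Module.End.mul_apply]
    exact hW.mono (by push_cast; omega) (hW.pow_mem (j := j) rfl _ h)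

/-- `N` is strict with respect to the filtration shifted by `−2`:
`N (W k) = range N ⊓ W (k−2)`. -/
theorem monodromyWeightFiltration_strict [FiniteDimensional K V]
    {N : V →ₗ[K] V} (hN : IsNilpotent N)
    {W : ℤ → Submodule K V} (hW : IsMonodromyWeightFiltration W N) (k : ℤ) :
    Submodule.map N (W k) = LinearMap.range N ⊓ W (k - 2) := by
  apply le_antisymm
  · rintro _ ⟨x, hx, rfl⟩
    exact ⟨⟨x, rfl⟩, hW.map_le k x hx⟩
  · rintro y ⟨⟨x, rfl⟩, hy⟩
    rcases le_total k 1 with hk | hk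
    · obtain ⟨a, ha⟩ := hW.eventually_bot
      obtain ⟨z, hz, hzy⟩ := mwf_lift hW a ha (k - 2 - a).toNat (k - 2) (by omega) (by omega) _ hy
      exact ⟨z, by simpa using hz, hzy⟩
    · obtain ⟨b, hb⟩ := hW.eventually_top
      refine ⟨x, mwf_descend hW k (by omega) (b - k).toNat x ?_ hy, rfl⟩
      rw [hb _ (by omega)]
      trivial
end

section
/- Let K be a field, V a finite-dimensional K-vector space, and N : V → V a nilpotent K-linear endomorphism with monodromy weight filtration W(N). Let N* : V* → V* be the dual (transpose) map on the dual space V* = Hom_K(V, K); it is nilpotent. Then the monodromy weight filtration of N* is given by annihilators: W(N*) k = (W(N) (−k−1))^⊥, the annihilator in V* of W(N) (−k−1), for every k ∈ ℤ. -/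
variable {K V : Type*} [Field K] [AddCommGroup V] [Module K V]

theorem IsMonodromyWeightFiltration.surj_elem {W : ℤ → Submodule K V} {N : V →ₗ[K] V}
    (hW : IsMonodromyWeightFiltration W N) (m : ℕ) (y : V) (hy : y ∈ W (-m)) :
    ∃ x ∈ W m, y - (N ^ m) x ∈ W (-m - 1) := by
  obtain ⟨q, hq⟩ := (hW.bijective (m : ℤ) (by positivity)).2
    (Submodule.Quotient.mk ⟨y, hy⟩)
  obtain ⟨x, rfl⟩ := Submodule.Quotient.mk_surjective _ q
  refine ⟨x.1, x.2, ?_⟩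
  have h := (Submodule.Quotient.eq _).1 hq.symm
  exact h

theorem IsMonodromyWeightFiltration.finrank_step [FiniteDimensional K V]
    {W : ℤ → Submodule K V} {N : V →ₗ[K] V}
    (hW : IsMonodromyWeightFiltration W N) (k : ℤ) (hk : 0 ≤ k) :
    Module.finrank K (W k) + Module.finrank K (W (-k - 1)) =
      Module.finrank K (W (k - 1)) + Module.finrank K (W (-k)) := by
  have e := (LinearEquiv.ofBijective _ (hW.bijective k hk)).finrank_eq
  have key : ∀ j : ℤ, Module.finrank K (gradedPiece W j) + Module.finrank K (W (j - 1))
      = Module.finrank K (W j) := by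
    intro j
    have h := Submodule.finrank_quotient_add_finrank
      (Submodule.comap (W j).subtype (W (j - 1)))
    have h2 := (Submodule.comapSubtypeEquivOfLe (hW.mono (by lia : j - 1 ≤ j))).finrank_eq
    rw [h2] at h
    exact h
  have h1 := key k
  have h2 := key (-k)
  lia

theorem IsMonodromyWeightFiltration.finrank_nat [FiniteDimensional K V]
    {W : ℤ → Submodule K V} {N : V →ₗ[K] V}
    (hW : IsMonodromyWeightFiltration W N) (k : ℕ) :
    Module.finrank K (W k) + Module.finrank K (W (-k - 1)) = Module.finrank K V := by
  have hc : ∀ n : ℕ, Module.finrank K (W (k + n : ℕ)) +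
      Module.finrank K (W (-(k + n : ℕ) - 1)) =
      Module.finrank K (W k) + Module.finrank K (W (-k - 1)) := by
    intro n
    induction n with
    | zero => simp
    | succ n ih =>
      have h := hW.finrank_step ((k + (n + 1) : ℕ) : ℤ) (by positivity)
      have e1 : ((k + (n + 1) : ℕ) : ℤ) - 1 = ((k + n : ℕ) : ℤ) := by push_cast; ring
      have e2 : -((k + (n + 1) : ℕ) : ℤ) = -((k + n : ℕ) : ℤ) - 1 := by push_cast; ring
      rw [h, e1, e2, ih]
  obtain ⟨a, ha⟩ := hW.eventually_bot
  obtain ⟨b, hb⟩ := hW.eventually_top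
  have h := hc (a.natAbs + b.natAbs)
  rw [hb ((k + (a.natAbs + b.natAbs) : ℕ) : ℤ) (by lia),
    ha (-((k + (a.natAbs + b.natAbs) : ℕ) : ℤ) - 1) (by lia)] at h
  simpa using h.symm

theorem IsMonodromyWeightFiltration.finrank_int [FiniteDimensional K V]
    {W : ℤ → Submodule K V} {N : V →ₗ[K] V}
    (hW : IsMonodromyWeightFiltration W N) (k : ℤ) :
    Module.finrank K (W k) + Module.finrank K (W (-k - 1)) = Module.finrank K V := by
  rcases le_or_gt 0 k with hk | hk
  · lift k to ℕ using hk
    exact hW.finrank_nat k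
  · obtain ⟨n, hn⟩ := Int.eq_ofNat_of_zero_le (by lia : 0 ≤ -k - 1)
    have h := hW.finrank_nat n
    have e : -(n : ℤ) - 1 = k := by lia
    rw [e] at h
    rw [hn, add_comm]
    exact h

theorem dualMap_pow_apply' (N : V →ₗ[K] V) (m : ℕ) (f : Module.Dual K V) (x : V) :
    (N.dualMap ^ m) f x = f ((N ^ m) x) := by
  induction m generalizing f with
  | zero => rfl
  | succ m ih =>
    rw [pow_succ, Module.End.mul_apply, ih, pow_succ', Module.End.mul_apply]
    rfl

theorem monodromy_pairing {N : V →ₗ[K] V}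
    {W : ℤ → Submodule K V} (hW : IsMonodromyWeightFiltration W N)
    {W' : ℤ → Submodule K (Module.Dual K V)}
    (hW' : IsMonodromyWeightFiltration W' N.dualMap)
    (k l : ℤ) (hkl : k + l < 0) (f : Module.Dual K V) (hf : f ∈ W' k) (x : V) (hx : x ∈ W l) :
    f x = 0 := by
  obtain ⟨a, ha⟩ := hW.eventually_bot
  obtain ⟨a', ha'⟩ := hW'.eventually_bot
  have outer : ∀ n : ℕ, ∀ k l : ℤ, k + l < 0 → k + l ≤ a + a' + n →
      ∀ f ∈ W' k, ∀ x ∈ W l, f x = 0 := by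
    intro n
    induction n with
    | zero =>
      intro k l _ h f hf x hx
      rcases le_or_gt l a with hl | hl
      · rw [ha l hl, Submodule.mem_bot] at hx
        simp [hx]
      · rw [ha' k (by push_cast at h; lia), Submodule.mem_bot] at hf
        simp [hf]
    | succ n ih =>
      have stepA : ∀ k l : ℤ, k < 0 → k + l < 0 → k + l ≤ a + a' + (n + 1 : ℕ) →
          (∀ f ∈ W' (-k), ∀ x ∈ W (l + 2 * k), f x = 0) →
          ∀ f ∈ W' k, ∀ x ∈ W l, f x = 0 := by
        intro k l hk hs hn H f hf x hx
        obtain ⟨m, rfl⟩ : ∃ m : ℕ, k = -m := ⟨k.natAbs, by lia⟩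
        obtain ⟨g, hg, hgf⟩ := hW'.surj_elem m f hf
        have h1 := ih (-m - 1) l (by lia) (by push_cast at hn; lia) _ hgf x hx
        rw [LinearMap.sub_apply, dualMap_pow_apply'] at h1
        rw [H g (by simpa using hg) _ (hW.pow_mem (by ring) x hx)] at h1
        simpa using h1
      have stepB : ∀ k l : ℤ, l < 0 → k + l < 0 → k + l ≤ a + a' + (n + 1 : ℕ) →
          (∀ f ∈ W' (k + 2 * l), ∀ x ∈ W (-l), f x = 0) →
          ∀ f ∈ W' k, ∀ x ∈ W l, f x = 0 := by
        intro k l hk hs hn H f hf x hx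
        obtain ⟨m, rfl⟩ : ∃ m : ℕ, l = -m := ⟨l.natAbs, by lia⟩
        obtain ⟨z, hz, hzx⟩ := hW.surj_elem m x hx
        have h1 := ih k (-m - 1) (by lia) (by push_cast at hn; lia) f hf _ hzx
        rw [map_sub, ← dualMap_pow_apply'] at h1
        rw [H _ (hW'.pow_mem (by ring) f hf) z (by simpa using hz)] at h1
        simpa using h1
      have inner : ∀ p : ℕ, ∀ k l : ℤ, l < 0 → l ≤ a + p → k + l < 0 →
          k + l ≤ a + a' + (n + 1 : ℕ) → ∀ f ∈ W' k, ∀ x ∈ W l, f x = 0 := by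
        intro p
        induction p with
        | zero =>
          intro k l _ hl _ _ f hf x hx
          rw [ha l (by simpa using hl), Submodule.mem_bot] at hx
          simp [hx]
        | succ p ihp =>
          intro k l hl hlp hs hn
          apply stepB k l hl hs hn
          apply stepA (k + 2 * l) (-l) (by lia) (by lia) (by lia)
          apply ihp <;> push_cast at * <;> lia
      intro k l hs hn
      rcases lt_or_ge l 0 with hl | hl
      · exact inner (l - a).natAbs k l hl (by lia) hs hn
      · apply stepA k l (by lia) hs hn
        exact inner (l + 2 * k - a).natAbs _ _ (by lia) (by lia) (by lia) (by lia)
  exact outer (k + l - a - a').natAbs k l hkl (by lia) f hf x hx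

/-- The dual map `N*` is nilpotent and its monodromy weight filtration
is given by annihilators: `W(N*) k = (W(N) (−k−1))^⊥`. -/
theorem monodromyWeightFiltration_dual [FiniteDimensional K V]
    {N : V →ₗ[K] V} (hN : IsNilpotent N)
    {W : ℤ → Submodule K V} (hW : IsMonodromyWeightFiltration W N) :
    IsNilpotent N.dualMap ∧
      ∀ W' : ℤ → Submodule K (Module.Dual K V),
        IsMonodromyWeightFiltration W' N.dualMap →
        ∀ k : ℤ, W' k = (W (-k - 1)).dualAnnihilator := by
  refine ⟨?_, ?_⟩
  · obtain ⟨n, hn⟩ := hN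
    refine ⟨n, ?_⟩
    ext f x
    rw [dualMap_pow_apply', hn]
    simp
  · intro W' hW' k
    have hle : ∀ j : ℤ, W' j ≤ (W (-j - 1)).dualAnnihilator := by
      intro j f hf
      rw [Submodule.mem_dualAnnihilator]
      intro x hx
      exact monodromy_pairing hW hW' j (-j - 1) (by lia) f hf x hx
    apply Submodule.eq_of_le_of_finrank_le (hle k)
    have d1 := Subspace.finrank_add_finrank_dualAnnihilator_eq (W (-k - 1))
    have d2 := Subspace.finrank_add_finrank_dualAnnihilator_eq (W (-(-k - 1) - 1))
    have l2 := Submodule.finrank_mono (hle (-k - 1))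
    have e1 := hW.finrank_int k
    have e2 := hW'.finrank_int k
    rw [Subspace.dual_finrank_eq] at e2
    rw [show -(-k - 1) - 1 = k by ring] at d2 l2
    lia
end
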